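/- arXiv:1805.11988 — 2 statements merged into one kernel-verified Lean document; each statement's English description precedes it below -/
import Mathlib

section
/- If two first-order terms t and u over a language L with variables in a type α are unifiable, then they have an idempotent most general unifier: there exists a most general unifier θ of t and u satisfying (θ x).subst θ = θ x for every variable x : α. -/
open FirstOrder

namespace FirstOrder.Language.Term

variable {L : Language} {α β γ : Type*}

/-- The number of symbols of a term. -/
def symbolCount : L.Term α → ℕ
  | var _ => 1
  | func _ ts => 1 + ∑ i, (ts i).symbolCount

theorem subst_subst (t : L.Term α) (θ : α → L.Term β) (ψ : β → L.Term γ) :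
    (t.subst θ).subst ψ = t.subst fun x => (θ x).subst ψ := by
  induction t with
  | var => rfl
  | func f ts ih => simp [subst, ih]

theorem symbolCount_le_symbolCount_subst [DecidableEq α] {x : α} (ψ : α → L.Term β)
    {t : L.Term α} (hx : x ∈ t.varFinset) :
    (ψ x).symbolCount ≤ (t.subst ψ).symbolCount := by
  induction t with
  | var y =>
    obtain rfl : x = y := by simpa [varFinset] using hx
    exact le_rfl
  | func f ts ih =>
    obtain ⟨i, hi⟩ : ∃ i, x ∈ (ts i).varFinset := by simpa [varFinset] using hx
    have hle := Finset.single_le_sum (f := fun j => ((ts j).subst ψ).symbolCount)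
      (fun _ _ => Nat.zero_le _) (Finset.mem_univ i)
    have := ih i hi
    simp only [subst, symbolCount]
    lia

/-- The occurs check: a variable cannot be unified with a different term containing it. -/
theorem notMem_varFinset_of_subst_eq [DecidableEq α] {x : α} {t : L.Term α} (hne : t ≠ var x)
    {ψ : α → L.Term β} (h : ψ x = t.subst ψ) : x ∉ t.varFinset := by
  intro hx
  cases t with
  | var y =>
    obtain rfl : x = y := by simpa [varFinset] using hx
    exact hne rfl
  | func f ts =>
    obtain ⟨i, hi⟩ : ∃ i, x ∈ (ts i).varFinset := by simpa [varFinset] using hx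
    have hle := Finset.single_le_sum (f := fun j => ((ts j).subst ψ).symbolCount)
      (fun _ _ => Nat.zero_le _) (Finset.mem_univ i)
    have := symbolCount_le_symbolCount_subst ψ hi
    have := congrArg symbolCount h
    simp only [subst, symbolCount] at this
    lia

theorem varFinset_subst [DecidableEq α] [DecidableEq β] (t : L.Term α) (θ : α → L.Term β) :
    (t.subst θ).varFinset = t.varFinset.biUnion fun x => (θ x).varFinset := by
  induction t with
  | var => simp [subst, varFinset]
  | func f ts ih => simp [subst, varFinset, ih, Finset.biUnion_biUnion]

/-- Distinct unifiable terms have a disagreement pair consisting of a variable and a term not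
containing it. -/
theorem exists_disagreement [DecidableEq α] {t u : L.Term α} (hne : t ≠ u)
    {θ : α → L.Term α} (h : t.subst θ = u.subst θ) :
    ∃ (x : α) (s : L.Term α), x ∈ t.varFinset ∪ u.varFinset ∧
      s.varFinset ⊆ t.varFinset ∪ u.varFinset ∧ x ∉ s.varFinset ∧
      ∀ ψ : α → L.Term α, t.subst ψ = u.subst ψ → ψ x = s.subst ψ := by
  induction t generalizing u with
  | var x =>
    exact ⟨x, u, by simp [varFinset], Finset.subset_union_right,
      notMem_varFinset_of_subst_eq hne.symm h, fun ψ hψ => hψ⟩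
  | @func n f ts ih =>
    cases u with
    | var x =>
      exact ⟨x, func f ts, by simp [varFinset], Finset.subset_union_left,
        notMem_varFinset_of_subst_eq hne h.symm, fun ψ hψ => hψ.symm⟩
    | @func m g us =>
      simp only [subst, func.injEq] at h
      obtain ⟨rfl, hfg, hargs⟩ := h
      obtain rfl := eq_of_heq hfg
      have hargs := congrFun (eq_of_heq hargs)
      obtain ⟨i, hi⟩ : ∃ i, ts i ≠ us i := by
        by_contra! hall
        exact hne (congrArg (func f) (funext hall))
      obtain ⟨x, s, hx, hs, hxs, hψ⟩ := ih i hi (hargs i)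
      have hsub : (ts i).varFinset ∪ (us i).varFinset ⊆
          (func f ts).varFinset ∪ (func f us).varFinset :=
        Finset.union_subset_union
          (Finset.subset_biUnion_of_mem (fun j => (ts j).varFinset) (Finset.mem_univ i))
          (Finset.subset_biUnion_of_mem (fun j => (us j).varFinset) (Finset.mem_univ i))
      refine ⟨x, s, hsub hx, hs.trans hsub, hxs, fun ψ h => hψ ψ ?_⟩
      simp only [subst, func.injEq, heq_eq_eq, true_and] at h
      exact congrFun h i

theorem subst_update_var_subst [DecidableEq α] {x : α} {s : L.Term α} {ψ : α → L.Term β}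
    (h : ψ x = s.subst ψ) (t : L.Term α) :
    (t.subst (Function.update var x s)).subst ψ = t.subst ψ := by
  rw [subst_subst]
  congr 1
  funext y
  by_cases hy : y = x
  · subst hy
    simp [h]
  · simp [hy, subst]

theorem varFinset_subst_update_var_subset [DecidableEq α] {x : α} {s t : L.Term α}
    {V : Finset α} (hxs : x ∉ s.varFinset) (hs : s.varFinset ⊆ V) (ht : t.varFinset ⊆ V) :
    (t.subst (Function.update var x s)).varFinset ⊆ V.erase x := by
  rw [varFinset_subst, Finset.biUnion_subset]
  intro y hy z hz
  by_cases hyx : y = x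
  · subst hyx
    rw [Function.update_self] at hz
    exact Finset.mem_erase.2 ⟨fun h => hxs (h ▸ hz), hs hz⟩
  · rw [Function.update_of_ne hyx, varFinset, Finset.mem_singleton] at hz
    subst hz
    exact Finset.mem_erase.2 ⟨hyx, ht hy⟩

/-- Unifiable terms have a unifier that is absorbed by every unifier. -/
theorem exists_unifier_absorbed (t u : L.Term α)
    (h : ∃ θ : α → L.Term α, t.subst θ = u.subst θ) :
    ∃ θ : α → L.Term α, t.subst θ = u.subst θ ∧
      ∀ ψ : α → L.Term α, t.subst ψ = u.subst ψ → ∀ x, (θ x).subst ψ = ψ x := by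
  classical
  obtain ⟨ψ₀, hψ₀⟩ := h
  induction hV : (t.varFinset ∪ u.varFinset).card using Nat.strong_induction_on
    generalizing t u with
  | _ n ih =>
    by_cases htu : t = u
    · exact ⟨var, by rw [htu], fun ψ _ x => rfl⟩
    obtain ⟨x, s, hx, hs, hxs, hψ⟩ := exists_disagreement htu hψ₀
    have hcard : ((t.subst (Function.update var x s)).varFinset ∪
        (u.subst (Function.update var x s)).varFinset).card < n := by
      rw [← hV]
      refine (Finset.card_le_card (Finset.union_subset ?_ ?_)).trans_lt
        (Finset.card_erase_lt_of_mem hx)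
      · exact varFinset_subst_update_var_subset hxs hs Finset.subset_union_left
      · exact varFinset_subst_update_var_subset hxs hs Finset.subset_union_right
    have hunif (ψ : α → L.Term α) (h : t.subst ψ = u.subst ψ) :
        (t.subst (Function.update var x s)).subst ψ =
          (u.subst (Function.update var x s)).subst ψ := by
      rw [subst_update_var_subst (hψ ψ h), subst_update_var_subst (hψ ψ h), h]
    obtain ⟨θ, hθ, hmin⟩ := ih _ hcard _ _ (hunif ψ₀ hψ₀) rfl
    refine ⟨fun y => (Function.update var x s y).subst θ, ?_, fun ψ h y => ?_⟩
    · rwa [← subst_subst, ← subst_subst]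
    · rw [subst_subst, funext (hmin ψ (hunif ψ h))]
      exact subst_update_var_subst (hψ ψ h) (var y)

end FirstOrder.Language.Term

theorem idempotent_mgu_exists {L : FirstOrder.Language} {α : Type*} (t u : L.Term α)
    (h : ∃ θ : α → L.Term α, t.subst θ = u.subst θ) :
    ∃ θ : α → L.Term α, t.subst θ = u.subst θ ∧
      (∀ ψ : α → L.Term α, t.subst ψ = u.subst ψ →
        ∃ σ : α → L.Term α, ∀ x : α, ψ x = (θ x).subst σ) ∧
      (∀ x : α, (θ x).subst θ = θ x) := by
  obtain ⟨θ, hθ, habs⟩ := FirstOrder.Language.Term.exists_unifier_absorbed t u h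
  exact ⟨θ, hθ, fun ψ hψ => ⟨ψ, fun x => (habs ψ hψ x).symm⟩, habs θ hθ⟩
end

section
/- Injectivity of isometric wirings: let α have decidable equality and let (uᵢ, vᵢ), i ∈ I, be a family of flows over a language L (so uᵢ.varFinset = vᵢ.varFinset for each i) whose left-hand terms are pairwise disjoint: for all i ≠ j there are no substitutions θ, ψ with uᵢ.subst θ = uⱼ.subst ψ. Then the action on closed terms is injective: if vᵢ.subst θ and vⱼ.subst ψ are closed terms and uᵢ.subst θ = uⱼ.subst ψ, then vᵢ.subst θ = vⱼ.subst ψ. -/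
open FirstOrder

/-- Two substitutions agree on a term exactly when they agree on the variables occurring in it. -/
theorem FirstOrder.Language.Term.subst_eq_subst_iff {L : FirstOrder.Language} {α β : Type*}
    [DecidableEq α] (t : L.Term α) (θ ψ : α → L.Term β) :
    t.subst θ = t.subst ψ ↔ ∀ a ∈ t.varFinset, θ a = ψ a := by
  induction t with
  | var a => simp
  | func f ts ih =>
    simp only [Language.Term.subst, Language.Term.varFinset, Language.Term.func.injEq, heq_eq_eq,
      true_and, funext_iff, ih, Finset.mem_biUnion, Finset.mem_univ, forall_exists_index]
    exact forall_comm

theorem isometric_wiring_injective {L : FirstOrder.Language} {α : Type*} [DecidableEq α]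
    {I : Type*} (u v : I → L.Term α)
    (hflow : ∀ i, (u i).varFinset = (v i).varFinset)
    (hdisj : ∀ i j, i ≠ j →
      ¬ ∃ θ ψ : α → L.Term α, (u i).subst θ = (u j).subst ψ)
    (i j : I) (θ ψ : α → L.Term α)
    (hci : ((v i).subst θ).varFinset = ∅) (hcj : ((v j).subst ψ).varFinset = ∅)
    (h : (u i).subst θ = (u j).subst ψ) :
    (v i).subst θ = (v j).subst ψ := by
  obtain rfl : i = j := by
    by_contra hij
    exact hdisj i j hij ⟨θ, ψ, h⟩
  rwa [Language.Term.subst_eq_subst_iff, hflow, ← Language.Term.subst_eq_subst_iff] at h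
end
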